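/- If G is the fan on n vertices (n ≥ 2), then gon(G) = min{ t + ⌈(n − 1 − t)/(t + 1)⌉ : t ∈ {⌊√n − 1⌋, ⌈√n − 1⌉} }. -/

import Mathlib

open SimpleGraph Finset
open scoped Classical

noncomputable section

def lap {V : Type} [Fintype V] (G : SimpleGraph V) (S : V → ℤ) : V → ℤ :=
  fun v => ∑ w : V, if G.Adj v w then S v - S w else 0

def Effective {V : Type} (D : V → ℤ) : Prop := ∀ v, 0 ≤ D v

def degDiv {V : Type} [Fintype V] (D : V → ℤ) : ℤ := ∑ v, D v

def LinEquiv {V : Type} [Fintype V] (G : SimpleGraph V) (D D' : V → ℤ) : Prop :=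
  ∃ S : V → ℤ, D' = D - lap G S

def PosRank {V : Type} [Fintype V] (G : SimpleGraph V) (D : V → ℤ) : Prop :=
  ∀ v : V, ∃ D' : V → ℤ, Effective D' ∧ LinEquiv G D D' ∧ 1 ≤ D' v

def gonality {V : Type} [Fintype V] (G : SimpleGraph V) : ℕ :=
  sInf {n : ℕ | ∃ D : V → ℤ, Effective D ∧ PosRank G D ∧ degDiv D = (n : ℤ)}

def indic {V : Type} (A : Set V) : V → ℤ := fun v => if v ∈ A then 1 else 0

/-- The fan on `n` vertices: a path on `n - 1` vertices (`some i`, with `i` adjacent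
to `i+1`) together with a universal vertex `none`. -/
def fan (n : ℕ) : SimpleGraph (Option (Fin (n - 1))) :=
  SimpleGraph.fromRel (fun a b =>
    match a, b with
    | none, some _ => True
    | some i, some j => (i : ℕ) + 1 = (j : ℕ)
    | _, _ => False)

section General

variable {V : Type} [Fintype V] (G : SimpleGraph V)

lemma lap_add (S T : V → ℤ) : lap G (S + T) = lap G S + lap G T := by
  funext v
  simp only [lap, Pi.add_apply, ← Finset.sum_add_distrib]
  refine Finset.sum_congr rfl fun w _ => ?_
  split_ifs <;> ring

lemma lap_neg (S : V → ℤ) : lap G (-S) = -lap G S := by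
  funext v
  simp only [lap, Pi.neg_apply, ← Finset.sum_neg_distrib]
  refine Finset.sum_congr rfl fun w _ => ?_
  split_ifs <;> ring

lemma sum_lap (S : V → ℤ) : ∑ v, lap G S v = 0 := by
  have h : ∑ v, lap G S v = -∑ v, lap G S v := by
    simp only [lap]
    conv_lhs => rw [Finset.sum_comm]
    simp only [← Finset.sum_neg_distrib]
    refine Finset.sum_congr rfl fun v _ => Finset.sum_congr rfl fun w _ => ?_
    simp only [G.adj_comm w v]
    split_ifs <;> ring
  omega

variable {G}

lemma LinEquiv.refl (D : V → ℤ) : LinEquiv G D D :=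
  ⟨0, by funext v; simp [lap]⟩

lemma LinEquiv.symm {D D' : V → ℤ} (h : LinEquiv G D D') : LinEquiv G D' D := by
  obtain ⟨S, rfl⟩ := h
  exact ⟨-S, by rw [lap_neg]; abel⟩

lemma LinEquiv.trans {D D' D'' : V → ℤ} (h : LinEquiv G D D') (h' : LinEquiv G D' D'') :
    LinEquiv G D D'' := by
  obtain ⟨S, rfl⟩ := h
  obtain ⟨T, rfl⟩ := h'
  exact ⟨S + T, by rw [lap_add]; abel⟩

lemma LinEquiv.degDiv_eq {D D' : V → ℤ} (h : LinEquiv G D D') : degDiv D' = degDiv D := by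
  obtain ⟨S, rfl⟩ := h
  simp [degDiv, Finset.sum_sub_distrib, sum_lap]

lemma Effective.le_degDiv {D : V → ℤ} (h : Effective D) (u : V) : D u ≤ degDiv D :=
  Finset.single_le_sum (fun v _ => h v) (Finset.mem_univ u)

lemma PosRank.congr {D D' : V → ℤ} (h : PosRank G D) (hD : LinEquiv G D D') :
    PosRank G D' := fun v => by
  obtain ⟨E, hE, hDE, hv⟩ := h v
  exact ⟨E, hE, hD.symm.trans hDE, hv⟩

lemma exists_maximal_at {D : V → ℤ} (hD : Effective D) (u : V) :
    ∃ D', Effective D' ∧ LinEquiv G D D' ∧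
      ∀ E, Effective E → LinEquiv G D' E → E u ≤ D' u := by
  obtain ⟨k, ⟨D', hD', hDD', rfl⟩, hmax⟩ :=
    Int.exists_greatest_of_bdd
      (P := fun z => ∃ D', Effective D' ∧ LinEquiv G D D' ∧ D' u = z)
      ⟨degDiv D, by
        rintro _ ⟨D', hD', hDD', rfl⟩
        exact (hD'.le_degDiv u).trans hDD'.degDiv_eq.le⟩
      ⟨_, D, hD, .refl D, rfl⟩
  exact ⟨D', hD', hDD', fun E hE hDE => hmax _ ⟨E, hE, hDD'.trans hDE, rfl⟩⟩

/-- Among effective divisors with the largest possible value at `u`, reaching a vertex `w` outside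
the support requires a legal set-firing move whose fired set contains `u` but not `w`. -/
lemma exists_legal_firing {D : V → ℤ} {u w : V} (hD : Effective D)
    (hmax : ∀ E, Effective E → LinEquiv G D E → E u ≤ D u) (hu : ∀ v, v ≠ u → G.Adj u v)
    (hw : D w = 0) (hrank : PosRank G D) :
    ∃ A : Finset V, u ∈ A ∧ w ∉ A ∧
      ∀ v ∈ A, ((Finset.univ.filter fun x => G.Adj v x ∧ x ∉ A).card : ℤ) ≤ D v := by
  obtain ⟨E, hE, ⟨S, hS⟩, hEw⟩ := hrank w
  obtain ⟨m, -, hm⟩ := Finset.exists_max_image Finset.univ S ⟨u, Finset.mem_univ u⟩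
  set A : Finset V := Finset.univ.filter fun v => S v = S m with hA
  have key : ∀ v ∈ A,
      E v + ((Finset.univ.filter fun x => G.Adj v x ∧ x ∉ A).card : ℤ) ≤ D v := by
    intro v hv
    have hvm : S v = S m := (Finset.mem_filter.1 hv).2
    have h1 : ((Finset.univ.filter fun x => G.Adj v x ∧ x ∉ A).card : ℤ) ≤ lap G S v := by
      rw [Finset.card_filter, lap]
      push_cast
      refine Finset.sum_le_sum fun x _ => ?_
      have hx := hm x (Finset.mem_univ x)
      have hxA : x ∈ A ↔ S x = S m := by simp [hA]
      simp only [hxA]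
      by_cases hvx : G.Adj v x <;> by_cases hxm : S x = S m <;> simp [hvx, hxm] <;> omega
    have h2 : E v = D v - lap G S v := by rw [hS]; rfl
    omega
  have hwA : w ∉ A := fun h => by
    have := key w h
    omega
  have hlegal : ∀ v ∈ A,
      ((Finset.univ.filter fun x => G.Adj v x ∧ x ∉ A).card : ℤ) ≤ D v := fun v hv => by
    have := key v hv
    have := hE v
    omega
  refine ⟨A, ?_, hwA, hlegal⟩
  by_contra huA
  set F : V → ℤ := fun v => if v ∈ A then 1 else 0 with hF
  have hEff : Effective (D - lap G F) := by
    intro v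
    simp only [Pi.sub_apply, sub_nonneg]
    by_cases hv : v ∈ A
    · refine le_trans ?_ (hlegal v hv)
      rw [Finset.card_filter, lap]
      push_cast
      refine Finset.sum_le_sum fun x _ => ?_
      by_cases hvx : G.Adj v x <;> by_cases hx : x ∈ A <;> simp [hF, hvx, hx, hv]
    · refine le_trans (Finset.sum_nonpos fun x _ => ?_) (hD v)
      by_cases hvx : G.Adj v x <;> by_cases hx : x ∈ A <;> simp [hF, hvx, hx, hv]
  have h1 := hmax _ hEff ⟨F, rfl⟩
  have h2 : lap G F u < 0 := by
    refine Finset.sum_neg' (fun x _ => ?_) ⟨m, Finset.mem_univ m, ?_⟩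
    · by_cases hvx : G.Adj u x <;> by_cases hx : x ∈ A <;> simp [hF, hvx, hx, huA]
    · have hmA : m ∈ A := by simp [hA]
      have : G.Adj u m := hu m (by rintro rfl; exact huA hmA)
      simp [hF, this, huA, hmA]
  simp only [Pi.sub_apply] at h1
  omega

end General

lemma fan_adj_none_some {n : ℕ} (i : Fin (n - 1)) : (fan n).Adj none (some i) := by
  simp [fan]

lemma fan_adj_some_none {n : ℕ} (i : Fin (n - 1)) : (fan n).Adj (some i) none :=
  (fan_adj_none_some i).symm

lemma fan_adj_some_some {n : ℕ} (i j : Fin (n - 1)) :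
    (fan n).Adj (some i) (some j) ↔ (i : ℕ) + 1 = j ∨ (j : ℕ) + 1 = i := by
  simp only [fan, fromRel_adj, ne_eq, Option.some.injEq, and_iff_right_iff_imp]
  rintro h rfl
  omega

/-- If every point outside `P` lies in a set of at most `k` points of the path that can only be
left through `P`, then the complement of `P` consists of at most `#P + 1` runs of length at
most `k`. -/
lemma le_card_add_of_cover {m k : ℕ} (P : Finset (Fin m))
    (h : ∀ w ∉ P, ∃ C : Finset (Fin m), w ∈ C ∧ C.card ≤ k ∧
      ∀ i j : Fin m, i ∈ C → (i : ℕ) + 1 = j → j ∉ P → j ∈ C) :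
    m ≤ P.card + (P.card + 1) * k := by
  set f : Fin m → ℕ := fun w => (P.filter (· < w)).card with hf
  have hmono : Monotone f := fun a b hab => by
    refine Finset.card_le_card fun x hx => ?_
    simp only [Finset.mem_filter] at hx ⊢
    exact ⟨hx.1, hx.2.trans_le hab⟩
  have hcard : Pᶜ.card ≤ k * (Finset.range (P.card + 1)).card := by
    refine Finset.card_le_mul_card_image_of_maps_to (f := f) (fun w _ => ?_) k fun c _ => ?_
    · exact Finset.mem_range.2 (Nat.lt_succ_of_le (Finset.card_filter_le _ _))
    · rcases (Pᶜ.filter fun w => f w = c).eq_empty_or_nonempty with he | hne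
      · rw [he]; simp
      obtain ⟨w, hw, hmin⟩ := Finset.exists_min_image _ id hne
      simp only [Finset.mem_filter, Finset.mem_compl, id] at hw hmin
      obtain ⟨C, hwC, hCk, hC⟩ := h w hw.1
      refine (Finset.card_le_card fun x hx => ?_).trans hCk
      simp only [Finset.mem_filter, Finset.mem_compl] at hx
      have hwx := hmin x hx
      have hrun : ∀ d : ℕ, ∀ y : Fin m, (y : ℕ) = w + d → y ≤ x → y ∈ C := by
        intro d
        induction d with
        | zero =>
          intro y hy _
          rwa [show y = w from Fin.ext (by simpa using hy)]
        | succ d ih =>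
          intro y hy hyx
          have hz : (w : ℕ) + d < m := by omega
          refine hC ⟨w + d, hz⟩ y (ih _ rfl (le_trans ?_ hyx)) (by simp only; omega) ?_
          · rw [Fin.le_def]; simp only; omega
          · intro hyP
            have hyx' : y < x := lt_of_le_of_ne hyx (by rintro rfl; exact hx.1 hyP)
            have hlt : f w < f x := by
              refine Finset.card_lt_card (Finset.ssubset_iff_of_subset ?_ |>.2 ⟨y, ?_, ?_⟩)
              · intro z hz
                simp only [Finset.mem_filter] at hz ⊢
                exact ⟨hz.1, hz.2.trans_le hwx⟩
              · simp [hyP, hyx']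
              · simp only [Finset.mem_filter, not_and, not_lt]
                intro _
                rw [Fin.le_def]; omega
            omega
      rw [Fin.le_def] at hwx
      exact hrun (x - w) x (by omega) le_rfl
  have := Finset.card_add_card_compl P
  simp only [Fintype.card_fin, Finset.card_range] at this hcard
  rw [mul_comm] at hcard
  omega

lemma degDiv_fan {n : ℕ} (D : Option (Fin (n - 1)) → ℤ) :
    degDiv D = D none + ∑ i, D (some i) := Fintype.sum_option _

lemma four_mul_le_of_posRank_fan {n : ℕ} {d : ℕ} {D : Option (Fin (n - 1)) → ℤ}
    (hD : Effective D) (hrank : PosRank (fan n) D) (hdeg : degDiv D = d) :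
    4 * n ≤ (d + 2) ^ 2 := by
  obtain ⟨D, hD', hDD', hmax⟩ := exists_maximal_at (G := fan n) hD none
  replace hrank := hrank.congr hDD'
  rw [← hDD'.degDiv_eq] at hdeg
  clear hDD'
  set P : Finset (Fin (n - 1)) := Finset.univ.filter fun i => D (some i) ≠ 0 with hP
  obtain ⟨k, hk⟩ := Int.eq_ofNat_of_zero_le (hD' none)
  have hPd : (P.card : ℤ) ≤ ∑ i, D (some i) := by
    rw [hP, Finset.card_filter]
    push_cast
    refine Finset.sum_le_sum fun i _ => ?_
    have := hD' (some i)
    split_ifs <;> omega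
  have hcover : n - 1 ≤ P.card + (P.card + 1) * k := by
    refine le_card_add_of_cover P fun w hw => ?_
    have hw0 : D (some w) = 0 := by simpa [hP] using hw
    obtain ⟨A, huA, hwA, hA⟩ := exists_legal_firing hD' hmax
      (fun v hv => by
        obtain ⟨i, rfl⟩ := Option.ne_none_iff_exists'.1 hv
        exact fan_adj_none_some i) hw0 hrank
    refine ⟨Finset.univ.filter fun i => some i ∉ A, by simpa using hwA, ?_, ?_⟩
    · have h1 := hA none huA
      rw [hk, Nat.cast_le] at h1
      refine le_trans ?_ h1
      refine Finset.card_le_card_of_injOn some (fun i hi => ?_)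
        ((Option.some_injective _).injOn)
      simpa [fan_adj_none_some] using hi
    · intro i j hi hij hjP
      simp only [Finset.mem_filter, Finset.mem_univ, true_and] at hi ⊢
      intro hjA
      have hj0 : D (some j) = 0 := by simpa [hP] using hjP
      have h1 := hA _ hjA
      simp only [hj0, Nat.cast_nonpos, Finset.card_eq_zero, Finset.eq_empty_iff_forall_notMem,
        Finset.mem_filter, Finset.mem_univ, true_and] at h1
      exact h1 (some i) ⟨(fan_adj_some_some j i).2 (.inr hij), hi⟩
  rw [degDiv_fan, hk] at hdeg
  have hpk : P.card + k ≤ d := by omega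
  have h1 : n ≤ (P.card + 1) * (k + 1) := by
    have : (P.card + 1) * (k + 1) = P.card + (P.card + 1) * k + 1 := by ring
    omega
  have h2 : (P.card + k + 2) ^ 2 ≤ (d + 2) ^ 2 := Nat.pow_le_pow_left (by omega) 2
  zify at *
  nlinarith [sq_nonneg ((P.card : ℤ) - k)]

lemma four_mul_le_gonality_fan {n : ℕ} : 4 * n ≤ (gonality (fan n) + 2) ^ 2 := by
  have hne : {d : ℕ | ∃ D, Effective D ∧ PosRank (fan n) D ∧ degDiv D = (d : ℤ)}.Nonempty := by
    refine ⟨Fintype.card (Option (Fin (n - 1))), fun _ => 1, fun _ => zero_le_one,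
      fun v => ⟨_, fun _ => zero_le_one, .refl _, le_rfl⟩, ?_⟩
    simp [degDiv]
  obtain ⟨D, hD, hrank, hdeg⟩ := Nat.sInf_mem hne
  exact four_mul_le_of_posRank_fan hD hrank hdeg

/-- The divisor with `q - 1` chips on the universal vertex and one chip on every `q`-th path
vertex. -/
def combDiv (n q : ℕ) : Option (Fin (n - 1)) → ℤ
  | none => (q : ℤ) - 1
  | some i => if (i : ℕ) % q + 1 = q then 1 else 0

lemma effective_combDiv {n q : ℕ} (hq : 2 ≤ q) : Effective (combDiv n q) := by
  rintro (_ | i)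
  · simp only [combDiv]; omega
  · simp only [combDiv]; split_ifs <;> simp

lemma degDiv_combDiv_le {n q : ℕ} (hq : 2 ≤ q) :
    degDiv (combDiv n q) ≤ ((q - 1 + (n - 1) / q : ℕ) : ℤ) := by
  rw [degDiv_fan]
  have h : (Finset.univ.filter fun i : Fin (n - 1) => (i : ℕ) % q + 1 = q).card
      ≤ (Finset.range ((n - 1) / q)).card := by
    refine Finset.card_le_card_of_injOn (fun i => (i : ℕ) / q) (fun i hi => ?_) ?_
    · simp only [Finset.coe_filter, Finset.mem_univ, true_and, Set.mem_ofPred_eq] at hi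
      simp only [Finset.coe_range, Set.mem_Iio]
      rw [← Nat.succ_le_iff, Nat.le_div_iff_mul_le (by omega), Nat.succ_mul, mul_comm]
      have := Nat.div_add_mod (i : ℕ) q
      have := i.isLt
      omega
    · intro i hi j hj hij
      simp only [Finset.coe_filter, Finset.mem_univ, true_and, Set.mem_ofPred_eq] at hi hj
      simp only at hij
      have h1 := Nat.div_add_mod (i : ℕ) q
      have h2 := Nat.div_add_mod (j : ℕ) q
      rw [hij] at h1
      exact Fin.ext (by omega)
  rw [Finset.card_range, Finset.card_filter] at h
  have h' : ∑ i, combDiv n q (some i) ≤ ((n - 1) / q : ℕ) := by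
    refine le_trans (le_of_eq ?_) (Int.ofNat_le.2 h)
    push_cast
    rfl
  push_cast [show 1 ≤ q by omega] at h' ⊢
  simp only [combDiv] at h' ⊢
  omega

lemma succ_div_of_mod_ne {q a : ℕ} (hq : 0 < q) (h : a % q + 1 ≠ q) : (a + 1) / q = a / q := by
  have h1 := Nat.div_add_mod a q
  have h2 := Nat.mod_lt a hq
  rw [Nat.div_eq_iff hq]
  rw [mul_comm] at h1
  omega

lemma posRank_combDiv {n q : ℕ} (hq : 2 ≤ q) : PosRank (fan n) (combDiv n q) := by
  have hq0 : 0 < q := by omega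
  rintro (_ | i)
  · exact ⟨_, effective_combDiv hq, .refl _, by simp only [combDiv]; omega⟩
  by_cases hi : (i : ℕ) % q + 1 = q
  · exact ⟨_, effective_combDiv hq, .refl _, by simp [combDiv, hi]⟩
  set C : Finset (Fin (n - 1)) :=
    Finset.univ.filter fun j => (j : ℕ) / q = (i : ℕ) / q ∧ (j : ℕ) % q + 1 ≠ q with hC
  have hmem : ∀ j, j ∈ C ↔ (j : ℕ) / q = (i : ℕ) / q ∧ (j : ℕ) % q + 1 ≠ q := by simp [hC]
  have hCcard : C.card ≤ q - 1 := by
    rw [← Finset.card_range (q - 1)]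
    refine Finset.card_le_card_of_injOn (fun j => (j : ℕ) % q) (fun j hj => ?_) ?_
    · have hj' := (hmem j).1 hj
      have := Nat.mod_lt (j : ℕ) hq0
      simp only [Finset.coe_range, Set.mem_Iio]
      omega
    · intro j hj l hl hjl
      have hj' := (hmem j).1 hj
      have hl' := (hmem l).1 hl
      simp only at hjl
      have h1 := Nat.div_add_mod (j : ℕ) q
      have h2 := Nat.div_add_mod (l : ℕ) q
      rw [hj'.1, hjl] at h1
      rw [hl'.1] at h2
      exact Fin.ext (by omega)
  set S : Option (Fin (n - 1)) → ℤ := fun v => v.elim 0 fun j => if j ∈ C then -1 else 0 with hS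
  have hSnone : S none = 0 := rfl
  have hSsome : ∀ j, S (some j) = if j ∈ C then -1 else 0 := fun j => rfl
  have hSC : ∀ j ∈ C, lap (fan n) S (some j) ≤ -1 := by
    intro j hj
    simp only [lap, Fintype.sum_option, fan_adj_some_none, if_true, hSnone, hSsome, hj]
    have : ∑ w : Fin (n - 1), (if (fan n).Adj (some j) (some w) then
        (-1 : ℤ) - (if w ∈ C then -1 else 0) else 0) ≤ 0 :=
      Finset.sum_nonpos fun w _ => by split_ifs <;> simp
    linarith
  refine ⟨combDiv n q - lap (fan n) S, ?_, ⟨S, rfl⟩, ?_⟩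
  · rintro (_ | j)
    · simp only [Pi.sub_apply, combDiv, lap, Fintype.sum_option, SimpleGraph.irrefl, if_false,
        fan_adj_none_some, if_true, hSnone, hSsome]
      have : ∑ w : Fin (n - 1), ((0 : ℤ) - if w ∈ C then -1 else 0) = C.card := by
        rw [Finset.sum_congr rfl (g := fun w => if w ∈ C then (1 : ℤ) else 0)
          (fun w _ => by split_ifs <;> simp)]
        simp
      rw [this]
      omega
    by_cases hj : j ∈ C
    · have h1 := hSC j hj
      have h2 := effective_combDiv (n := n) hq (some j)
      simp only [Pi.sub_apply]
      omega
    · have hlap : lap (fan n) S (some j) =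
          ((Finset.univ.filter fun w => (fan n).Adj (some j) (some w) ∧ w ∈ C).card : ℤ) := by
        rw [Finset.card_filter]
        push_cast
        simp only [lap, Fintype.sum_option, fan_adj_some_none, if_true, hSnone, hSsome, hj,
          if_false, sub_zero, zero_add]
        refine Finset.sum_congr rfl fun w _ => ?_
        by_cases h1 : (fan n).Adj (some j) (some w) <;> by_cases h2 : w ∈ C <;> simp [h1, h2]
      simp only [Pi.sub_apply, hlap, combDiv, sub_nonneg]
      by_cases hjq : (j : ℕ) % q + 1 = q
      · simp only [hjq, if_true]
        have h1 : (Finset.univ.filter fun w =>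
            (fan n).Adj (some j) (some w) ∧ w ∈ C).card ≤ 1 := by
          rw [Finset.card_le_one]
          have hdiff : ∀ a b : Fin (n - 1), a ∈ C → b ∈ C → (a : ℕ) + 1 = j →
              (j : ℕ) + 1 = b → False := by
            intro a b ha hb haj hjb
            have ha' := (hmem a).1 ha
            have hb' := (hmem b).1 hb
            have h1 : (j : ℕ) / q = (i : ℕ) / q := by
              rw [← haj, succ_div_of_mod_ne hq0 ha'.2, ha'.1]
            have h2 := Nat.div_add_mod (j : ℕ) q
            have h3 := Nat.div_add_mod (b : ℕ) q
            rw [hb'.1] at h3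
            rw [h1] at h2
            have := Nat.mod_lt (b : ℕ) hq0
            omega
          intro a ha b hb
          simp only [Finset.mem_filter, Finset.mem_univ, true_and, fan_adj_some_some] at ha hb
          refine Fin.ext ?_
          rcases ha with ⟨ha | ha, haC⟩ <;> rcases hb with ⟨hb | hb, hbC⟩
          · omega
          · exact (hdiff b a hbC haC hb ha).elim
          · exact (hdiff a b haC hbC ha hb).elim
          · omega
        exact_mod_cast h1
      · simp only [hjq, if_false]
        refine le_of_eq ?_
        rw [Nat.cast_eq_zero, Finset.card_eq_zero, Finset.filter_eq_empty_iff]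
        rintro w - ⟨hw, hwC⟩
        have hwC' := (hmem w).1 hwC
        refine hj ((hmem j).2 ⟨?_, hjq⟩)
        rcases (fan_adj_some_some j w).1 hw with h | h
        · rw [← succ_div_of_mod_ne hq0 hjq, h, hwC'.1]
        · rw [← h, succ_div_of_mod_ne hq0 hwC'.2, hwC'.1]
  · have h1 := hSC i ((hmem i).2 ⟨rfl, hi⟩)
    have h2 := effective_combDiv (n := n) hq (some i)
    simp only [Pi.sub_apply]
    omega

lemma gonality_fan_le {n q : ℕ} (hq : 2 ≤ q) : gonality (fan n) ≤ q - 1 + (n - 1) / q := by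
  have hdeg : 0 ≤ degDiv (combDiv n q) := Finset.sum_nonneg fun v _ => effective_combDiv hq v
  obtain ⟨d, hd⟩ := Int.eq_ofNat_of_zero_le hdeg
  have h1 : gonality (fan n) ≤ d :=
    Nat.sInf_le ⟨_, effective_combDiv hq, posRank_combDiv hq, hd⟩
  have h2 := degDiv_combDiv_le (n := n) hq
  omega

lemma ceil_sub_div_eq {n s c : ℤ} (hs : 0 < s) (h1 : s * (c - 1) < n) (h2 : n ≤ s * c) :
    ⌈((n : ℚ) - 1 - ((s - 1 : ℤ) : ℚ)) / (((s - 1 : ℤ) : ℚ) + 1)⌉ = c - 1 := by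
  have hs' : (0 : ℚ) < s := by exact_mod_cast hs
  have h1' : (s : ℚ) * (c - 1) < n := by exact_mod_cast h1
  have h2' : (n : ℚ) ≤ s * c := by exact_mod_cast h2
  rw [Int.ceil_eq_iff]
  push_cast
  rw [sub_add_cancel, lt_div_iff₀ hs', div_le_iff₀ hs']
  constructor <;> nlinarith

/-- If `G` is the fan on `n ≥ 2` vertices, then
`gon(G) = min{t + ⌈(n - 1 - t)/(t + 1)⌉ : t ∈ {⌊√n - 1⌋, ⌈√n - 1⌉}}`. -/
theorem stmt_8 (n : ℕ) (hn : 2 ≤ n) :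
    (gonality (fan n) : ℤ) =
      min (⌊Real.sqrt n - 1⌋ +
            ⌈((n : ℚ) - 1 - (⌊Real.sqrt n - 1⌋ : ℚ)) / ((⌊Real.sqrt n - 1⌋ : ℚ) + 1)⌉)
          (⌈Real.sqrt n - 1⌉ +
            ⌈((n : ℚ) - 1 - (⌈Real.sqrt n - 1⌉ : ℚ)) / ((⌈Real.sqrt n - 1⌉ : ℚ) + 1)⌉) := by
  obtain ⟨r, hr⟩ : ∃ r, r = Nat.sqrt n := ⟨_, rfl⟩
  have hr1 : r * r ≤ n := hr ▸ Nat.sqrt_le n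
  have hr2 : n < (r + 1) * (r + 1) := hr ▸ Nat.lt_succ_sqrt n
  have hr0 : 1 ≤ r := by
    by_contra h
    have : r = 0 := by omega
    subst this
    omega
  have hfloor : ⌊Real.sqrt n - 1⌋ = (r : ℤ) - 1 := by
    rw [Int.floor_sub_one, Real.floor_real_sqrt_eq_nat_sqrt, hr]
  have hlow := four_mul_le_gonality_fan (n := n)
  rw [hfloor]
  have hcast : (n : ℚ) = ((n : ℤ) : ℚ) := by simp
  rw [hcast]
  obtain hsq | hlt := hr1.eq_or_lt
  · have hceil : ⌈Real.sqrt n - 1⌉ = (r : ℤ) - 1 := by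
      rw [← hsq, Nat.cast_mul, Real.sqrt_mul_self (Nat.cast_nonneg r)]
      rw [Int.ceil_sub_one, Int.ceil_natCast]
    have hr2 : 2 ≤ r := by
      by_contra h
      have : r = 1 := by omega
      subst this
      omega
    rw [hceil, ceil_sub_div_eq (c := r) (by omega) (by zify at *; nlinarith)
      (by zify at *; nlinarith), min_self]
    have hup := gonality_fan_le (n := n) hr2
    have hdiv : (n - 1) / r < r := by
      rw [Nat.div_lt_iff_lt_mul (by omega)]
      omega
    have : 2 * r ≤ gonality (fan n) + 2 :=
      (Nat.pow_le_pow_iff_left two_ne_zero).1 (by rw [mul_pow]; nlinarith)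
    omega
  · have hceil : ⌈Real.sqrt n - 1⌉ = (r + 1 : ℤ) - 1 := by
      rw [Int.ceil_sub_one]
      congr 1
      rw [Int.ceil_eq_iff]
      push_cast
      rw [add_sub_cancel_right]
      constructor
      · rw [Real.lt_sqrt (Nat.cast_nonneg r), sq]
        exact_mod_cast hlt
      · rw [Real.sqrt_le_left (by positivity), sq]
        exact_mod_cast hr2.le
    rw [hceil]
    have hup := gonality_fan_le (n := n) (q := r + 1) (by omega)
    rcases Nat.lt_or_ge (r * (r + 1)) n with hbig | hsmall
    · rw [ceil_sub_div_eq (c := r + 2) (by omega) (by zify at *; nlinarith)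
        (by zify at *; nlinarith), ceil_sub_div_eq (c := r + 1) (by omega)
        (by zify at *; nlinarith) (by zify at *; nlinarith)]
      have hdiv : (n - 1) / (r + 1) < r + 1 := by
        rw [Nat.div_lt_iff_lt_mul (by omega)]
        omega
      have : 2 * r + 1 < gonality (fan n) + 2 :=
        (Nat.pow_lt_pow_iff_left two_ne_zero).1 (by nlinarith)
      omega
    · rw [ceil_sub_div_eq (c := r + 1) (by omega) (by zify at *; nlinarith)
        (by zify at *; nlinarith), ceil_sub_div_eq (c := r) (by omega)
        (by zify at *; nlinarith) (by zify at *; nlinarith)]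
      have hdiv : (n - 1) / (r + 1) < r := by
        rw [Nat.div_lt_iff_lt_mul (by omega)]
        omega
      have : 2 * r < gonality (fan n) + 2 :=
        (Nat.pow_lt_pow_iff_left two_ne_zero).1 (by nlinarith)
      omega
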